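/- The cycle C_5 is not a thundercloud-forest graph. -/

import Mathlib

/-- `I` is a cloud witnessing that `H` is a cloud-forest graph: `I` is independent,
the complement of `I` induces a forest `F`, every edge from `I` goes to a leaf or
isolated vertex of `F` (degree at most 1 in `F`), and no two adjacent leaves of `F`
both send edges to `I`. -/
def CloudForestWitness {V : Type*} (H : SimpleGraph V) (I : Set V) : Prop :=
  (∀ u ∈ I, ∀ v ∈ I, ¬ H.Adj u v) ∧
  (H.induce Iᶜ).IsAcyclic ∧
  (∀ u ∈ I, ∀ v, H.Adj u v → {w | w ∉ I ∧ H.Adj v w}.ncard ≤ 1) ∧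
  (∀ v w, v ∉ I → w ∉ I → H.Adj v w →
    (∃ u ∈ I, H.Adj u v) → (∃ u ∈ I, H.Adj u w) → False)

/-- `H` is a cloud-forest graph. -/
def IsCloudForestGraph {V : Type*} (H : SimpleGraph V) : Prop :=
  ∃ I : Set V, CloudForestWitness H I


/-- `I` witnesses that `H` is a thundercloud-forest graph: it is a cloud-forest
witness and moreover every odd cycle of `H` uses at least two vertices of `I`. -/
def ThundercloudForestWitness {V : Type*} (H : SimpleGraph V) (I : Set V) : Prop :=
  CloudForestWitness H I ∧
  ∀ (v : V) (c : H.Walk v v), c.IsCycle → Odd c.length →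
    2 ≤ {x ∈ I | x ∈ c.support}.ncard

/-- `H` is a thundercloud-forest graph. -/
def IsThundercloudForestGraph {V : Type*} (H : SimpleGraph V) : Prop :=
  ∃ I : Set V, ThundercloudForestWitness H I

/-- The cycle `C₅` is not a thundercloud-forest graph. -/
theorem stmt5 : ¬ IsThundercloudForestGraph (SimpleGraph.cycleGraph 5) := by
  rintro ⟨I, ⟨hind, -, -, hleaf⟩, hodd⟩
  have key : ∀ a b : Fin 5, a ≠ b → (SimpleGraph.cycleGraph 5).Adj a b ∨
      ∃ v w, (SimpleGraph.cycleGraph 5).Adj v w ∧ (SimpleGraph.cycleGraph 5).Adj a v ∧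
        (SimpleGraph.cycleGraph 5).Adj b w := by decide
  have h01 : (SimpleGraph.cycleGraph 5).Adj 0 1 := by decide
  have h12 : (SimpleGraph.cycleGraph 5).Adj 1 2 := by decide
  have h23 : (SimpleGraph.cycleGraph 5).Adj 2 3 := by decide
  have h34 : (SimpleGraph.cycleGraph 5).Adj 3 4 := by decide
  have h40 : (SimpleGraph.cycleGraph 5).Adj 4 0 := by decide
  have h2 := hodd 0 (.cons h01 (.cons h12 (.cons h23 (.cons h34 (.cons h40 .nil)))))
    (by simp [SimpleGraph.Walk.isCycle_def, SimpleGraph.Walk.isTrail_def])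
    (by simp only [SimpleGraph.Walk.length_cons, SimpleGraph.Walk.length_nil]; decide)
  obtain ⟨a, b, ha, hb, hab⟩ := (Set.one_lt_ncard_iff (Set.toFinite _)).1 h2
  rcases key a b hab with h | ⟨v, w, hvw, hav, hbw⟩
  · exact hind a ha.1 b hb.1 h
  · exact hleaf v w (fun hv => hind a ha.1 v hv hav) (fun hw => hind b hb.1 w hw hbw) hvw
      ⟨a, ha.1, hav⟩ ⟨b, hb.1, hbw⟩
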